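/- Define T₀(5) = −0.1382, T₀(6) = −0.0711, T₀(7) = −0.01362, and a(5) = a(6) = 0.1, a(7) = 3.75/49. For each n ∈ {5, 6, 7}, each t with −1.301 ≤ t ≤ T₀(n), and each ρ with 3·a(n)/π ≤ ρ ≤ 1, one has I(circPerim0(ρπ/3 − 2t), n, t, ρ) > 0, i.e., √(4π·a − a²) − t·B' + (5 − n)·p₅' − ρ·p₅ > 0 where a = ρπ/3 − 2t. -/

import Mathlib

open Real

/-- Perimeter of a regular spherical `n`-gon of area `x` on the unit sphere. -/
noncomputable def regPerim (x n : ℝ) : ℝ :=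
  n * Real.arccos ((Real.cos (2 * π / n) +
      (Real.cos ((π - (2 * π - x) / n) / 2)) ^ 2) /
      (Real.sin ((π - (2 * π - x) / n) / 2)) ^ 2)

/-- Circumference of a circle on the unit sphere enclosing area `a`. -/
noncomputable def circPerim0 (a : ℝ) : ℝ := Real.sqrt (4 * π * a - a ^ 2)

/-- Perimeter of the regular spherical pentagon of area `π/3`. -/
noncomputable def p5 : ℝ := 5 * Real.arccos ((4 * Real.cos (2 * π / 5) + 1) / 3)

/-- Derivative at `n = 5` of `n ↦ regPerim (π/3) n`. -/
noncomputable def p5' : ℝ := deriv (fun n : ℝ => regPerim (π / 3) n) 5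

/-- `B' = -∂₁ regPerim (π/3, 5)`. -/
noncomputable def B' : ℝ := - deriv (fun x : ℝ => regPerim x 5) (π / 3)

/-- The isoperimetric functional `I(ℓ, n, t, ρ)`. -/
noncomputable def Ifun (ℓ n t ρ : ℝ) : ℝ := ℓ - t * B' + (5 - n) * p5' - ρ * p5

/-- The constant `ρ₁` of the proof (values specified only for `n = 5, 6, 7`). -/
noncomputable def rho1 : ℕ → ℝ
  | 5 => 0.913
  | 6 => 0.952
  | 7 => 0.99
  | _ => 1

/-- The constant `T₁` of the proof (values specified only for `n = 5, 6, 7`). -/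
noncomputable def T1 : ℕ → ℝ
  | 5 => 0.117
  | 6 => 0.065
  | 7 => 0.0134
  | _ => 0

/-- The constant `T₀` of the proof (values specified only for `n = 5, 6, 7`). -/
noncomputable def T0 : ℕ → ℝ
  | 5 => -0.1382
  | 6 => -0.0711
  | 7 => -0.01362
  | _ => 0

/-- The constant `ρ₂` of the proof (values specified only for `n = 5, 6, 7`). -/
noncomputable def rho2 : ℕ → ℝ
  | 5 => 0.913
  | 6 => 0.952
  | 7 => 0.99
  | _ => 1

/-- The upper bound `R(n)`: `0.9957` for `n = 5` and `1` otherwise. -/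
noncomputable def Rbd : ℕ → ℝ
  | 5 => 0.9957
  | _ => 1

/-- The area lower bound `a(n) = min (3.75 / n², 0.1)`. -/
noncomputable def aFn (n : ℕ) : ℝ := min (3.75 / (n : ℝ) ^ 2) 0.1

lemma cos_two_pi_div_five : cos (2 * π / 5) = (√5 - 1) / 4 := by
  have h5 : √5 ^ 2 = 5 := sq_sqrt (by norm_num)
  rw [mul_div_assoc, cos_two_mul, cos_pi_div_five]
  linarith

lemma cos_side_pentagon :
    (cos (2 * π / 5) + cos (π / 3) ^ 2) / sin (π / 3) ^ 2 = √5 / 3 := by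
  rw [sin_pi_div_three, cos_pi_div_three, cos_two_pi_div_five, div_pow √3, sq_sqrt (by norm_num)]
  ring

/-- Derivative of the angle inside `regPerim` at the regular pentagon of area `π / 3`,
along a curve of central angles `γ` and half interior angles `β`. -/
lemma hasDerivAt_arccos_pentagon {γ β : ℝ → ℝ} {γ' β' x : ℝ}
    (hγ : HasDerivAt γ γ' x) (hβ : HasDerivAt β β' x)
    (hγx : γ x = 2 * π / 5) (hβx : β x = π / 3) :
    HasDerivAt (fun y => arccos ((cos (γ y) + cos (β y) ^ 2) / sin (β y) ^ 2))
      (2 * sin (2 * π / 5) * γ' + √3 * (3 + √5) / 3 * β') x := by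
  have h3 : √3 ^ 2 = 3 := sq_sqrt (by norm_num)
  have h5 : √5 ^ 2 = 5 := sq_sqrt (by norm_num)
  have h5' : √5 < 3 := by
    rw [sqrt_lt' (by norm_num)]; norm_num
  have hsin : sin (β x) ^ 2 ≠ 0 := by
    rw [hβx, sin_pi_div_three, div_pow, h3]; norm_num
  have hval : (cos (γ x) + cos (β x) ^ 2) / sin (β x) ^ 2 = √5 / 3 := by
    rw [hγx, hβx, cos_side_pentagon]
  have hroot : √(1 - (√5 / 3) ^ 2) = 2 / 3 := by
    rw [div_pow, h5, sqrt_eq_iff_mul_self_eq (by norm_num) (by norm_num)]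
    norm_num
  have hquot := (hγ.cos.add (hβ.cos.pow 2)).div (hβ.sin.pow 2) hsin
  have harccos : HasDerivAt arccos (-(3 / 2)) ((cos (γ x) + cos (β x) ^ 2) / sin (β x) ^ 2) := by
    rw [hval]
    have h := hasDerivAt_arccos (x := √5 / 3)
      (by linarith [sqrt_nonneg (5 : ℝ)]) (by linarith)
    rw [hroot] at h
    convert h using 1
    norm_num
  refine (harccos.comp x hquot).congr_deriv ?_
  simp only [Pi.add_apply, Pi.pow_apply, hγx, hβx, sin_pi_div_three, cos_pi_div_three,
    cos_two_pi_div_five]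
  field_simp
  linear_combination (36 * √3 * β' - 24 * √3 ^ 2 * sin (2 * π / 5) * γ'
    - (12 + 4 * √5) * √3 * β' * (√3 ^ 2 + 3)) * h3

lemma B'_eq : B' = -(√3 * (3 + √5) / 6) := by
  have hβ : HasDerivAt (fun x : ℝ => (π - (2 * π - x) / 5) / 2) (1 / 10) (π / 3) := by
    refine ((((hasDerivAt_id (π / 3)).const_sub (2 * π)).div_const 5).const_sub π).div_const 2
      |>.congr_deriv ?_
    norm_num
  have h := (hasDerivAt_arccos_pentagon (hasDerivAt_const (π / 3) (2 * π / 5)) hβ rfl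
    (by ring)).const_mul 5
  have h' : deriv (fun x : ℝ => regPerim x 5) (π / 3) = _ := h.deriv
  rw [B', h']
  ring

lemma p5_eq : p5 = 5 * arccos (√5 / 3) := by
  rw [p5, cos_two_pi_div_five]
  ring_nf

lemma p5'_eq : p5' = arccos (√5 / 3) - 4 * π / 5 * sin (2 * π / 5)
    + √3 * (3 + √5) * π / 18 := by
  have hγ : HasDerivAt (fun n : ℝ => 2 * π / n) (-(2 * π / 25)) 5 := by
    refine (hasDerivAt_const (5 : ℝ) (2 * π)).div (hasDerivAt_id 5) (by norm_num)
      |>.congr_deriv ?_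
    simp only [id]
    ring
  have hβ : HasDerivAt (fun n : ℝ => (π - (2 * π - π / 3) / n) / 2) (π / 30) 5 := by
    refine (((hasDerivAt_const (5 : ℝ) (2 * π - π / 3)).div (hasDerivAt_id 5)
      (by norm_num)).const_sub π).div_const 2 |>.congr_deriv ?_
    simp only [id]
    ring
  have h := (hasDerivAt_id (5 : ℝ)).mul (hasDerivAt_arccos_pentagon hγ hβ rfl (by ring))
  have h' : p5' = _ := h.deriv
  have hval : (cos (2 * π / 5) + cos ((π - (2 * π - π / 3) / 5) / 2) ^ 2) /
      sin ((π - (2 * π - π / 3) / 5) / 2) ^ 2 = √5 / 3 := by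
    rw [show (π - (2 * π - π / 3) / 5) / 2 = π / 3 by ring, cos_side_pentagon]
  rw [h', hval]
  simp only [id]
  ring

lemma arccos_sqrt_five_div_three_le : arccos (√5 / 3) ≤ 0.72972772 := by
  have hπ := pi_lt_d20
  have hπ' := pi_gt_d20
  have hsin : sin 0.1113409 ≤ 1 / 9 := by
    have h := (abs_le.1 (sin_bound (x := 0.1113409) (by norm_num [abs_le]))).2
    rw [abs_of_pos (by norm_num)] at h
    norm_num at h ⊢
    linarith
  have hcos : cos (π / 4 - 0.05567045) ≤ √5 / 3 := by
    have h2 : √2 ^ 2 = 2 := sq_sqrt (by norm_num)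
    have hsq : cos (π / 4 - 0.05567045) ^ 2 = (1 + sin 0.1113409) / 2 := by
      rw [cos_sub, cos_pi_div_four, sin_pi_div_four,
        show (0.1113409 : ℝ) = 2 * 0.05567045 by norm_num, sin_two_mul]
      linear_combination (cos 0.05567045 + sin 0.05567045) ^ 2 / 4 * h2
        + sin_sq_add_cos_sq 0.05567045 / 2
    refine abs_le_of_sq_le_sq' ?_ (by positivity) |>.2
    rw [hsq, div_pow, sq_sqrt (by norm_num)]
    linarith
  calc arccos (√5 / 3) ≤ arccos (cos (π / 4 - 0.05567045)) := arccos_le_arccos hcos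
    _ = π / 4 - 0.05567045 := arccos_cos (by linarith) (by linarith)
    _ ≤ 0.72972772 := by linarith

lemma p5_le : p5 ≤ 3.6486386 := by
  rw [p5_eq]
  linarith [arccos_sqrt_five_div_three_le]

lemma sqrt_five_lt : √5 < 2.236067978 := by
  rw [sqrt_lt' (by norm_num)]; norm_num

lemma sqrt_three_lt : √3 < 1.732050808 := by
  rw [sqrt_lt' (by norm_num)]; norm_num

lemma sqrt_three_mul_lt : √3 * (3 + √5) < 9.0691359 :=
  calc √3 * (3 + √5) ≤ 1.732050808 * (3 + 2.236067978) := by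
        gcongr
        exacts [sqrt_three_lt.le, sqrt_five_lt.le]
    _ < 9.0691359 := by norm_num

lemma neg_B'_le : -B' ≤ 1.5115227 := by
  rw [B'_eq]
  linarith [sqrt_three_mul_lt]

lemma p5'_le : p5' ≤ -0.0776751 := by
  have hsin : 0.9510565 ≤ sin (2 * π / 5) := by
    have hpos : 0 ≤ sin (2 * π / 5) :=
      sin_nonneg_of_nonneg_of_le_pi (by positivity) (by linarith [pi_pos])
    refine abs_le_of_sq_le_sq' ?_ hpos |>.2
    rw [sin_sq, cos_two_pi_div_five]
    nlinarith [sqrt_five_lt, sq_sqrt (show (0 : ℝ) ≤ 5 by norm_num), sqrt_nonneg (5 : ℝ)]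
  rw [p5'_eq]
  have hle : √3 * (3 + √5) / 18 - 4 / 5 * sin (2 * π / 5) ≤ -0.2570043 := by
    linarith [sqrt_three_mul_lt]
  have := mul_le_mul_of_nonneg_left hle pi_pos.le
  linarith [arccos_sqrt_five_div_three_le, pi_gt_d20]

/-- It suffices to bound `circPerim0` from below with `π` replaced by `3.14159265`, and the
resulting quadratic is concave in `(t, ρ)`, so only its values at the corners of the box matter. -/
lemma Ifun_circPerim0_pos {n t ρ T : ℝ} (hn : 5 ≤ n) (ht : -1.301 ≤ t) (htT : t ≤ T)
    (hT : T ≤ 0) (hρ : 0 ≤ ρ) (hρ1 : ρ ≤ 1)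
    (hquad : (-1.5115227 * t + 0.0776751 * (5 - n) + 3.6486386 * ρ) ^ 2 <
      (ρ * 3.14159265 / 3 - 2 * t) * (3.14159265 * (4 - ρ / 3) + 2 * t)) :
    0 < Ifun (circPerim0 (ρ * π / 3 - 2 * t)) n t ρ := by
  have hπ : 3.14159265 ≤ π := by linarith [pi_gt_d20]
  have hroot : -1.5115227 * t + 0.0776751 * (5 - n) + 3.6486386 * ρ <
      circPerim0 (ρ * π / 3 - 2 * t) := by
    refine lt_sqrt_of_sq_lt (hquad.trans_le ?_)
    calc _ ≤ (ρ * π / 3 - 2 * t) * (π * (4 - ρ / 3) + 2 * t) := by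
          gcongr <;> nlinarith
      _ = _ := by ring
  rw [Ifun]
  nlinarith [mul_le_mul_of_nonneg_left p5_le hρ, neg_B'_le, p5'_le]

theorem case_T_very_neg :
    ∀ n ∈ ({5, 6, 7} : Set ℕ), ∀ t ∈ Set.Icc (-1.301 : ℝ) (T0 n),
      ∀ ρ ∈ Set.Icc (3 * aFn n / π) 1,
        Ifun (circPerim0 (ρ * π / 3 - 2 * t)) (n : ℝ) t ρ > 0 := by
  rintro n hn t ⟨ht, htT⟩ ρ ⟨hρ, hρ1⟩
  have hρ0 : 0 ≤ ρ := by
    refine le_trans ?_ hρ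
    unfold aFn
    positivity
  rcases hn with rfl | rfl | rfl <;> simp only [T0] at htT <;>
    refine Ifun_circPerim0_pos (by norm_num) ht htT (by norm_num) hρ0 hρ1 ?_ <;>
    · push_cast
      nlinarith [mul_nonneg (sub_nonneg.2 ht) (sub_nonneg.2 htT),
        mul_nonneg hρ0 (sub_nonneg.2 hρ1),
        mul_nonneg (sub_nonneg.2 ht) hρ0, mul_nonneg (sub_nonneg.2 ht) (sub_nonneg.2 hρ1),
        mul_nonneg (sub_nonneg.2 htT) hρ0, mul_nonneg (sub_nonneg.2 htT) (sub_nonneg.2 hρ1)]
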